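/- arXiv:2507.07501 — 4 statements merged into one kernel-verified Lean document; each statement's English description precedes it below -/
import Mathlib

section
/- If a profile P⁰_C of responsive couple preferences satisfies extreme-altruism, then for every extension of P⁰_C — i.e., every preference profile P = ({P_d}_{d∈D}, {P_c}_{c∈C}, {P_h}_{h∈H}) with responsive hospital preferences and with P_c = P⁰_c for all couples c — there exists a stable matching. -/
/- A formal framework for many-to-one matching markets with couples
(hospitals/doctors), following the paper's definitions.  The dummy hospital
`λ` is modelled as `none : Option H`. -/

namespace CouplesMarket

open Finset

/-- A strict linear order on a subset `s` of `α`:  trichotomy on `s`,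
irreflexivity, transitivity and asymmetry. -/
def StrictLinearOn {α : Type} (s : Set α) (r : α → α → Prop) : Prop :=
  (∀ a ∈ s, ∀ b ∈ s, a = b ∨ r a b ∨ r b a) ∧
  (∀ a ∈ s, ¬ r a a) ∧
  (∀ a ∈ s, ∀ b ∈ s, ∀ c ∈ s, r a b → r b c → r a c) ∧
  (∀ a ∈ s, ∀ b ∈ s, r a b → ¬ r b a)

/-- A strict linear order on all of `α`. -/
def StrictLinear {α : Type} (r : α → α → Prop) : Prop :=
  StrictLinearOn Set.univ r

/-- The weak (reflexive) part `R` of a strict preference `P`. -/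
def weakPref {α : Type} (r : α → α → Prop) (a b : α) : Prop := a = b ∨ r a b

/-- A matching market: hospitals `H` with capacities `κ`, doctors `D`, and a
set of (pairwise disjoint) couples `c = (f, m)` (first component in `F`,
second in `M`; the remaining doctors are single). -/
structure Market (D H : Type) where
  κ : H → ℕ
  couples : Finset (D × D)
  couples_ne : ∀ c ∈ couples, c.1 ≠ c.2
  couples_disjoint : ∀ c ∈ couples, ∀ c' ∈ couples, c ≠ c' →
    c.1 ≠ c'.1 ∧ c.1 ≠ c'.2 ∧ c.2 ≠ c'.1 ∧ c.2 ≠ c'.2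

/-- A doctor is single if he/she belongs to no couple. -/
def Market.Single {D H : Type} (M : Market D H) (d : D) : Prop :=
  ∀ c ∈ M.couples, d ≠ c.1 ∧ d ≠ c.2

/-- A preference profile: for each hospital `h` its set `acc h = D_h` of
acceptable doctors, its linear order `rank h = P̄_h` over individual doctors,
and its preference `hpref h = P_h` over feasible sets of doctors; for each
doctor `d` an individual (resp. marginal, for couple members) preference
`dpref d = P_d` over `H ∪ {λ}`; and for each couple `c` a preference
`cpref c = P_c` over pairs in `(H ∪ {λ})²`. -/
structure Profile (D H : Type) where
  acc : H → Finset D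
  rank : H → D → D → Prop
  hpref : H → Finset D → Finset D → Prop
  dpref : D → Option H → Option H → Prop
  cpref : D × D → Option H × Option H → Option H × Option H → Prop

variable {D H : Type} [Fintype D] [DecidableEq D] [Fintype H] [DecidableEq H]

/-- Responsiveness of hospital `h`'s preference over feasible sets of doctors:
`rank h` is a linear order on `acc h`; `hpref h` is a linear order on feasible
sets; every nonempty feasible subset of acceptable doctors is preferred to `∅`;
singleton comparisons agree with `rank h`; adding a common acceptable doctor to
two feasible subsets of acceptable doctors preserves their comparison; and `∅`
is preferred to every feasible set not contained in `acc h`. -/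
def HospResponsive (M : Market D H) (P : Profile D H) (h : H) : Prop :=
  StrictLinearOn {d | d ∈ P.acc h} (P.rank h) ∧
  StrictLinearOn {A : Finset D | A.card ≤ M.κ h} (P.hpref h) ∧
  (∀ A : Finset D, A ⊆ P.acc h → A.Nonempty → A.card ≤ M.κ h → P.hpref h A ∅) ∧
  (∀ d ∈ P.acc h, ∀ d' ∈ P.acc h, d ≠ d' → (P.hpref h {d} {d'} ↔ P.rank h d d')) ∧
  (∀ A B : Finset D, A ⊆ P.acc h → B ⊆ P.acc h → A.card < M.κ h → B.card < M.κ h →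
      ∀ d ∈ P.acc h, d ∉ A → d ∉ B →
        (P.hpref h (insert d A) (insert d B) ↔ P.hpref h A B)) ∧
  (∀ A : Finset D, A.card ≤ M.κ h → ¬ A ⊆ P.acc h → P.hpref h ∅ A)

/-- Responsiveness of a couple's preference over pairs of hospitals with
respect to the induced marginal preferences of its two members. -/
def CoupleResponsive (P : Profile D H) (c : D × D) : Prop :=
  StrictLinear (P.cpref c) ∧ StrictLinear (P.dpref c.1) ∧ StrictLinear (P.dpref c.2) ∧
  (∀ h h₁ h₂ : Option H,
    (P.cpref c (h₁, h) (h₂, h) ↔ P.dpref c.1 h₁ h₂) ∧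
    (P.cpref c (h, h₁) (h, h₂) ↔ P.dpref c.2 h₁ h₂))

/-- A fully responsive preference profile. -/
def Responsive (M : Market D H) (P : Profile D H) : Prop :=
  (∀ h : H, HospResponsive M P h) ∧
  (∀ c ∈ M.couples, CoupleResponsive P c) ∧
  (∀ d : D, M.Single d → StrictLinear (P.dpref d))

/-- A matching: each doctor is assigned a hospital in `H ∪ {λ}` (where `none`
means unemployed), respecting capacities.  (Disjointness of the hospitals'
sets of doctors is automatic, and the dummy hospital has capacity `|D|`.) -/
structure Matching {D H : Type} [Fintype D] [DecidableEq D] [DecidableEq H]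
    (M : Market D H) : Type where
  assign : D → Option H
  quota : ∀ h : H, (Finset.univ.filter fun d => assign d = some h).card ≤ M.κ h

/-- `μ(h)`, the set of doctors matched with hospital `h`. -/
def Matching.assigned {M : Market D H} (μ : Matching M) (h : H) : Finset D :=
  Finset.univ.filter fun d => μ.assign d = some h

/-- Hospital `h ∈ H ∪ {λ}` prefers the set of doctors `A` to (a subset of) its
assignment at `μ`: there is `B ⊆ μ(h)` disjoint from `A` such that the feasible
set `(μ(h) \ B) ∪ A` is preferred to `μ(h)`.  The dummy hospital always
prefers to have any doctors. -/
def HosPrefers (M : Market D H) (P : Profile D H) (μ : Matching M) :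
    Option H → Finset D → Prop
  | none, _ => True
  | some h, A => ∃ B ⊆ μ.assigned h, Disjoint A B ∧
      ((μ.assigned h \ B) ∪ A).card ≤ M.κ h ∧
      P.hpref h ((μ.assigned h \ B) ∪ A) (μ.assigned h)

/-- The pair `(h, s)` (hospital or dummy, single doctor) blocks `μ`. -/
def BlocksSingle (M : Market D H) (P : Profile D H) (μ : Matching M)
    (h : Option H) (s : D) : Prop :=
  P.dpref s h (μ.assign s) ∧ HosPrefers M P μ h {s}

/-- The pair `((h_f, h_m), c)` (pair of hospitals or dummies, couple `c = (f, m)`)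
blocks `μ`. -/
def BlocksCouple (M : Market D H) (P : Profile D H) (μ : Matching M)
    (hf hm : Option H) (c : D × D) : Prop :=
  P.cpref c (hf, hm) (μ.assign c.1, μ.assign c.2) ∧
  (hf ≠ hm → μ.assign c.1 ≠ hf → HosPrefers M P μ hf {c.1}) ∧
  (hf ≠ hm → μ.assign c.2 ≠ hm → HosPrefers M P μ hm {c.2}) ∧
  (hf = hm → HosPrefers M P μ hf {c.1, c.2})

/-- Stability: no single blocking pair, no couple blocking pair, and no
hospital prefers `∅` to its assignment. -/
def Stable (M : Market D H) (P : Profile D H) (μ : Matching M) : Prop :=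
  (∀ (h : Option H) (s : D), M.Single s → ¬ BlocksSingle M P μ h s) ∧
  (∀ (hf hm : Option H), ∀ c ∈ M.couples, ¬ BlocksCouple M P μ hf hm c) ∧
  (∀ h : H, ¬ HosPrefers M P μ (some h) ∅)

/-- Individual rationality. -/
def IndivRational (M : Market D H) (P : Profile D H) (μ : Matching M) : Prop :=
  (∀ s : D, M.Single s → weakPref (P.dpref s) (μ.assign s) none) ∧
  (∀ c ∈ M.couples, weakPref (P.cpref c) (μ.assign c.1, μ.assign c.2) (none, none)) ∧
  (∀ h : H, ∀ d ∈ μ.assigned h, d ∈ P.acc h)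

/-- Extreme-altruism of the profile of couple preferences: for every couple
`c = (f, m)`, every hospital `h` with `κ_h ≤ |D| - 2` and all
`h', h'' ∈ H ∪ {λ}`:  (i) `h' P_f h`, `h' R_f h''` and `h'' R_m λ` imply
`(h', h'') P_c (h, h)`; and (ii) symmetrically for `m`. -/
def ExtremeAltruism (M : Market D H) (P : Profile D H) : Prop :=
  ∀ c ∈ M.couples, ∀ h : H, M.κ h ≤ Fintype.card D - 2 →
    ∀ h' h'' : Option H,
      ((P.dpref c.1 h' (some h) ∧ weakPref (P.dpref c.1) h' h'' ∧
          weakPref (P.dpref c.2) h'' none) →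
        P.cpref c (h', h'') (some h, some h)) ∧
      ((P.dpref c.2 h' (some h) ∧ weakPref (P.dpref c.2) h' h'' ∧
          weakPref (P.dpref c.1) h'' none) →
        P.cpref c (h'', h') (some h, some h))

/-- Aversion to couple diversity of the profile of hospital preferences: for
every hospital `h`, every couple `c = (f, m)` of acceptable doctors and all
doctors `d₁, d₂` ranked strictly in between `f` and `m` by `h`, if more than
`κ_h` doctors are ranked above the worse member of the couple then
`{d₁, d₂} P_h {f, m}`. -/
def AversionToCoupleDiversity (M : Market D H) (P : Profile D H) : Prop :=
  ∀ h : H, ∀ c ∈ M.couples, c.1 ∈ P.acc h → c.2 ∈ P.acc h → ∀ d₁ d₂ : D,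
    ((P.rank h c.1 d₁ ∧ P.rank h d₁ d₂ ∧ P.rank h d₂ c.2 ∧
        M.κ h < {d : D | P.rank h d c.2}.ncard) ∨
     (P.rank h c.2 d₁ ∧ P.rank h d₁ d₂ ∧ P.rank h d₂ c.1 ∧
        M.κ h < {d : D | P.rank h d c.1}.ncard)) →
    P.hpref h {d₁, d₂} {c.1, c.2}

/-- `P` is an extension of the profile `P₀` of couple preferences: the couple
preferences (and hence their induced marginals) agree with `P₀`. -/
def CoupleExtension (M : Market D H) (P₀ P : Profile D H) : Prop :=
  ∀ c ∈ M.couples, P.cpref c = P₀.cpref c ∧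
    P.dpref c.1 = P₀.dpref c.1 ∧ P.dpref c.2 = P₀.dpref c.2

/-- `P` is an extension of the profile `P₀` of hospital preferences: the
hospital preferences (including the sets of acceptable doctors) agree with `P₀`. -/
def HospitalExtension (P₀ P : Profile D H) : Prop :=
  ∀ h : H, P.acc h = P₀.acc h ∧ P.rank h = P₀.rank h ∧ P.hpref h = P₀.hpref h

end CouplesMarket

namespace CouplesMarket

section Auxiliary

open Finset

/-- A strict linear order on a type has a greatest element in every nonempty finite set. -/
lemma StrictLinear.exists_top {α : Type} {r : α → α → Prop} (hr : StrictLinear r)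
    (s : Finset α) (hs : s.Nonempty) : ∃ a ∈ s, ∀ b ∈ s, weakPref r a b := by
  obtain ⟨h1, -, h3, -⟩ := hr
  induction hs using Finset.Nonempty.cons_induction with
  | singleton a => exact ⟨a, by simp, by simp [weakPref]⟩
  | cons a s ha _ ih =>
    obtain ⟨t, hts, ht⟩ := ih
    rcases h1 a trivial t trivial with rfl | h | h
    · exact absurd hts ha
    · refine ⟨a, by simp, fun b hb => ?_⟩
      rcases Finset.mem_cons.1 hb with rfl | hb
      · exact Or.inl rfl
      · rcases ht b hb with rfl | h'
        · exact Or.inr h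
        · exact Or.inr (h3 _ trivial _ trivial _ trivial h h')
    · refine ⟨t, by simp [hts], fun b hb => ?_⟩
      rcases Finset.mem_cons.1 hb with rfl | hb
      · exact Or.inr h
      · exact ht b hb

/-- A finite nonempty subset of a strictly linearly ordered set has a least element. -/
lemma StrictLinearOn.exists_bot {α : Type} {t : Set α} {r : α → α → Prop}
    (hr : StrictLinearOn t r) (s : Finset α) (hs : s.Nonempty) (hst : ∀ a ∈ s, a ∈ t) :
    ∃ a ∈ s, ∀ b ∈ s, b ≠ a → r b a := by
  obtain ⟨h1, -, h3, -⟩ := hr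
  induction hs using Finset.Nonempty.cons_induction with
  | singleton a => exact ⟨a, by simp, by simp⟩
  | cons a s ha _ ih =>
    obtain ⟨m, hms, hm⟩ := ih fun b hb => hst b (by simp [hb])
    have hmt := hst m (by simp [hms])
    have hat := hst a (by simp)
    rcases h1 a hat m hmt with rfl | h | h
    · exact absurd hms ha
    · refine ⟨m, by simp [hms], fun b hb hne => ?_⟩
      rcases Finset.mem_cons.1 hb with rfl | hb
      · exact h
      · exact hm b hb hne
    · refine ⟨a, by simp, fun b hb hne => ?_⟩
      rcases Finset.mem_cons.1 hb with rfl | hb'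
      · exact absurd rfl hne
      · by_cases hbm : b = m
        · exact hbm ▸ h
        · exact h3 _ (hst b hb) _ hmt _ hat (hm b hb' hbm) h

variable {D H : Type} [DecidableEq D]

/-- A responsive hospital that prefers a feasible set to an acceptable one accepts all of it. -/
lemma HospResponsive.subset_acc {M : Market D H} {P : Profile D H} {h : H}
    (hr : HospResponsive M P h) {X A : Finset D} (hA : A ⊆ P.acc h) (hAκ : A.card ≤ M.κ h)
    (hXκ : X.card ≤ M.κ h) (hpref : P.hpref h X A) : X ⊆ P.acc h := by
  obtain ⟨-, ⟨-, hirr, htr, has⟩, hne, -, -, hun⟩ := hr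
  by_contra hX
  have h1 := hun X hXκ hX
  rcases A.eq_empty_or_nonempty with rfl | hAn
  · exact has _ hXκ _ hAκ hpref h1
  · exact has _ hXκ _ hAκ hpref (htr _ hAκ _ (by simp) _ hXκ (hne A hA hAn hAκ) h1)

/-- Adding the same acceptable doctors to two feasible sets preserves their comparison. -/
lemma HospResponsive.union_iff {M : Market D H} {P : Profile D H} {h : H}
    (hr : HospResponsive M P h) {A B S : Finset D} (hA : A ⊆ P.acc h) (hB : B ⊆ P.acc h)
    (hS : S ⊆ P.acc h) (hAS : Disjoint A S) (hBS : Disjoint B S)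
    (hAκ : A.card + S.card ≤ M.κ h) (hBκ : B.card + S.card ≤ M.κ h) :
    P.hpref h (A ∪ S) (B ∪ S) ↔ P.hpref h A B := by
  induction S using Finset.induction_on with
  | empty => simp
  | insert d S hd ih =>
    rw [card_insert_of_notMem hd] at hAκ hBκ
    rw [disjoint_insert_right] at hAS hBS
    have hS' : S ⊆ P.acc h := (subset_insert _ _).trans hS
    rw [← ih hS' hAS.2 hBS.2 (by omega) (by omega), union_insert, union_insert]
    have := card_union_le A S
    have := card_union_le B S
    exact hr.2.2.2.2.1 _ _ (union_subset hA hS') (union_subset hB hS') (by omega) (by omega) d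
      (hS (mem_insert_self _ _)) (by simp [hAS.1, hd]) (by simp [hBS.1, hd])

/-- A responsive hospital does not prefer `X` to an acceptable set `A` that is at least as large
and all of whose members are ranked above the newcomers in `X`. -/
lemma HospResponsive.not_hpref_of_dominated {M : Market D H} {P : Profile D H} {h : H}
    (hr : HospResponsive M P h) {A : Finset D} (hA : A ⊆ P.acc h) (hAκ : A.card ≤ M.κ h)
    (X : Finset D) (hX : X.card ≤ A.card)
    (hdom : ∀ x ∈ X \ A, ∀ a ∈ A, P.rank h a x) : ¬ P.hpref h X A := by
  intro hpref
  have hXa := hr.subset_acc hA hAκ (hX.trans hAκ) hpref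
  obtain ⟨hirr, htr, has⟩ := hr.2.1.2
  induction hn : (X \ A).card generalizing X with
  | zero =>
    have hsub : X ⊆ A := sdiff_eq_empty_iff_subset.1 (card_eq_zero.1 hn)
    rcases hsub.eq_or_ssubset with rfl | hss
    · exact hirr _ hAκ hpref
    · have hne : (A \ X).Nonempty := sdiff_nonempty.2 hss.2
      have hcard := card_sdiff_add_card_eq_card hsub
      have h1 : P.hpref h (A \ X) ∅ :=
        hr.2.2.1 _ (sdiff_subset.trans hA) hne ((card_le_card sdiff_subset).trans hAκ)
      have h2 := (hr.union_iff (A := A \ X) (B := ∅) (S := X) (sdiff_subset.trans hA) (by simp)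
        hXa sdiff_disjoint (by simp) (by omega) (by simp; omega)).2 h1
      rw [sdiff_union_of_subset hsub, empty_union] at h2
      exact has _ (hX.trans hAκ) _ hAκ hpref h2
  | succ n ih =>
    obtain ⟨x, hx⟩ : (X \ A).Nonempty := card_pos.1 (by omega)
    have hle : (X \ A).card ≤ (A \ X).card := by
      have h1 := card_sdiff_add_card_inter X A
      have h2 := card_sdiff_add_card_inter A X
      rw [inter_comm] at h2
      omega
    obtain ⟨a, ha⟩ : (A \ X).Nonempty := card_pos.1 (by omega)
    obtain ⟨hxX, hxA⟩ := mem_sdiff.1 hx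
    obtain ⟨haA, haX⟩ := mem_sdiff.1 ha
    have hax : a ≠ x := fun he => haX (he ▸ hxX)
    have haE : a ∉ X.erase x := fun hm => haX (mem_of_mem_erase hm)
    have hcE := card_erase_add_one hxX
    have hcard : (insert a (X.erase x)).card = X.card := by rw [card_insert_of_notMem haE, hcE]
    have hswap : P.hpref h (insert a (X.erase x)) X := by
      have h1 := (hr.2.2.2.1 a (hA haA) x (hXa hxX) hax).2 (hdom x hx a haA)
      have h2 := (hr.union_iff (A := {a}) (B := {x}) (S := X.erase x) (by simpa using hA haA)
        (by simpa using hXa hxX) ((erase_subset _ _).trans hXa) (disjoint_singleton_left.2 haE) (by simp)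
        (by simp only [card_singleton]; omega) (by simp only [card_singleton]; omega)).2 h1
      rwa [singleton_union, singleton_union, insert_erase hxX] at h2
    have hdiff : insert a (X.erase x) \ A = (X \ A).erase x := by
      rw [insert_sdiff_of_mem _ haA, erase_sdiff_comm]
    refine ih (insert a (X.erase x)) (hcard ▸ hX) ?_ ?_ ?_ ?_
    · intro y hy
      rw [hdiff] at hy
      exact hdom y (mem_of_mem_erase hy)
    · exact htr _ (by simp only [Set.mem_ofPred_eq]; omega) _ (hX.trans hAκ) _ hAκ hswap hpref
    · exact insert_subset (hA haA) ((erase_subset _ _).trans hXa)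
    · rw [hdiff, card_erase_of_mem hx, hn]
      rfl

variable [Fintype D] [DecidableEq H]

/-- A hospital preferring to add the doctors in `S` ranks some newcomer in `S`, whom it accepts,
not below all of its doctors, or has a vacancy. -/
lemma HosPrefers.exists_not_dominated {M : Market D H} {P : Profile D H} {μ : Matching M} {h : H}
    (hr : HospResponsive M P h) (hacc : μ.assigned h ⊆ P.acc h) {S : Finset D}
    (hS : HosPrefers M P μ (some h) S) :
    S ⊆ P.acc h ∧ ((μ.assigned h).card = M.κ h →
      ∃ x ∈ S, x ∉ μ.assigned h ∧ ∃ a ∈ μ.assigned h, ¬ P.rank h a x) := by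
  obtain ⟨B, -, -, hcard, hpref⟩ := hS
  have hκ : (μ.assigned h).card ≤ M.κ h := μ.quota h
  refine ⟨subset_union_right.trans (hr.subset_acc hacc hκ hcard hpref), fun hfull => ?_⟩
  by_contra! hcon
  refine hr.not_hpref_of_dominated hacc hκ _ (hfull ▸ hcard) (fun x hx a ha => ?_) hpref
  simp only [mem_sdiff, mem_union] at hx
  exact hcon x (hx.1.resolve_left fun h' => hx.2 h'.1) hx.2 a ha

/-- An individually rational matching in which no acceptable doctor has justified envy or envies
a hospital with a vacancy is stable as soon as the couples are extremely altruistic. -/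
theorem ExtremeAltruism.stable {M : Market D H} {P : Profile D H} (hEA : ExtremeAltruism M P)
    (hresp : Responsive M P) (hd : ∀ d, StrictLinear (P.dpref d)) {μ : Matching M}
    (hir : ∀ d, weakPref (P.dpref d) (μ.assign d) none)
    (hacc : ∀ h, μ.assigned h ⊆ P.acc h)
    (hst : ∀ d h, d ∈ P.acc h → P.dpref d (some h) (μ.assign d) →
      (μ.assigned h).card = M.κ h ∧ ∀ e ∈ μ.assigned h, P.rank h e d) :
    Stable M P μ := by
  have single : ∀ d o, P.dpref d o (μ.assign d) → ¬ HosPrefers M P μ o {d} := by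
    intro d o hp hpref
    cases o with
    | none =>
      rcases hir d with h | h
      · exact (hd d).2.1 _ trivial (h ▸ hp)
      · exact (hd d).2.2.2 _ trivial _ trivial hp h
    | some h =>
      obtain ⟨hS, hx⟩ := hpref.exists_not_dominated (hresp.1 h) (hacc h)
      obtain ⟨hfull, hdom⟩ := hst d h (hS (mem_singleton_self d)) hp
      obtain ⟨x, hxS, -, a, ha, hn⟩ := hx hfull
      rw [mem_singleton.1 hxS] at hn
      exact hn (hdom a ha)
  -- if `f` envies `h`, and `h` wants the couple, then `m` is better off than at `h`
  have pair : ∀ f m h, f ≠ m → P.dpref f (some h) (μ.assign f) →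
      HosPrefers M P μ (some h) {f, m} →
      M.κ h ≤ Fintype.card D - 2 ∧ P.dpref m (μ.assign m) (some h) := by
    intro f m h hfm hp hpref
    obtain ⟨hS, hx⟩ := hpref.exists_not_dominated (hresp.1 h) (hacc h)
    obtain ⟨hfull, hdom⟩ := hst f h (hS (by simp)) hp
    obtain ⟨x, hxS, hxA, a, ha, hn⟩ := hx hfull
    have hxm : x = m := by
      rcases mem_insert.1 hxS with rfl | hxS
      · exact absurd (hdom a ha) hn
      · exact mem_singleton.1 hxS
    subst hxm
    have hfA : f ∉ μ.assigned h := by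
      intro hf
      rw [Matching.assigned, mem_filter] at hf
      exact (hd f).2.1 _ trivial (hf.2 ▸ hp)
    refine ⟨?_, ?_⟩
    · have hle := card_le_univ (insert f (insert x (μ.assigned h)))
      rw [card_insert_of_notMem (by simp [hfm, hfA]), card_insert_of_notMem hxA, hfull] at hle
      omega
    · rcases (hd x).1 (μ.assign x) trivial (some h) trivial with h1 | h1 | h1
      · exact absurd (by simp [Matching.assigned, h1]) hxA
      · exact h1
      · exact absurd ((hst x h (hS (by simp)) h1).2 a ha) hn
  refine ⟨fun h s _ hb => single s h hb.1 hb.2, fun hf hm c hc hb => ?_, fun h hp => ?_⟩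
  · obtain ⟨hcp, hbf, hbm, hbc⟩ := hb
    obtain ⟨⟨-, cirr, ctr, cas⟩, -, -, cresp⟩ := hresp.2.1 c hc
    have mono₁ : ∀ {a b k}, weakPref (P.dpref c.1) a b → weakPref (P.cpref c) (a, k) (b, k) :=
      fun h => h.imp (fun h => by rw [h]) ((cresp _ _ _).1.2)
    have mono₂ : ∀ {a b k}, weakPref (P.dpref c.2) a b → weakPref (P.cpref c) (k, a) (k, b) :=
      fun h => h.imp (fun h => by rw [h]) ((cresp _ _ _).2.2)
    have ctr' : ∀ {x y z}, weakPref (P.cpref c) x y → P.cpref c y z → P.cpref c x z := by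
      rintro x y z (rfl | h) h'
      · exact h'
      · exact ctr _ trivial _ trivial _ trivial h h'
    have himp : P.dpref c.1 hf (μ.assign c.1) ∨ P.dpref c.2 hm (μ.assign c.2) := by
      by_contra! hcon
      have h1 : weakPref (P.dpref c.1) (μ.assign c.1) hf := by
        rcases (hd c.1).1 hf trivial (μ.assign c.1) trivial with h | h | h
        exacts [Or.inl h.symm, absurd h hcon.1, Or.inr h]
      have h2 : weakPref (P.dpref c.2) (μ.assign c.2) hm := by
        rcases (hd c.2).1 hm trivial (μ.assign c.2) trivial with h | h | h
        exacts [Or.inl h.symm, absurd h hcon.2, Or.inr h]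
      exact cirr _ trivial (ctr' (mono₁ h1) (ctr' (mono₂ h2) hcp))
    have ne_of : ∀ d o, P.dpref d o (μ.assign d) → μ.assign d ≠ o :=
      fun d o hp he => (hd d).2.1 _ trivial (he ▸ hp)
    by_cases hne : hf = hm
    · subst hne
      have hpref := hbc rfl
      cases hf with
      | none =>
        rcases himp with hp | hp
        · exact single _ _ hp trivial
        · exact single _ _ hp trivial
      | some h =>
        rcases himp with hp | hp
        · obtain ⟨hκ, hm⟩ := pair _ _ h (M.couples_ne c hc) hp hpref
          have := (hEA c hc h hκ (μ.assign c.2) none).2 ⟨hm, hir c.2, Or.inl rfl⟩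
          exact cas _ trivial _ trivial hcp (ctr' (mono₁ (hir c.1)) this)
        · rw [pair_comm] at hpref
          obtain ⟨hκ, hm⟩ := pair _ _ h (M.couples_ne c hc).symm hp hpref
          have := (hEA c hc h hκ (μ.assign c.1) none).1 ⟨hm, hir c.1, Or.inl rfl⟩
          exact cas _ trivial _ trivial hcp (ctr' (mono₂ (hir c.2)) this)
    · rcases himp with hp | hp
      · exact single _ _ hp (hbf hne (ne_of _ _ hp))
      · exact single _ _ hp (hbm hne (ne_of _ _ hp))
  · obtain ⟨B, -, -, -, hpref⟩ := hp
    rw [union_empty] at hpref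
    refine (hresp.1 h).not_hpref_of_dominated (hacc h) (μ.quota h) _
      (card_le_card sdiff_subset) (fun x hx => ?_) hpref
    exact absurd (mem_sdiff.1 (mem_sdiff.1 hx).1).1 (mem_sdiff.1 hx).2

variable [Fintype H]

/-- Gale–Shapley: the many-to-one market given by the doctors' individual preferences and the
hospitals' rankings of acceptable doctors has a matching that is individually rational and in
which every hospital envied by a doctor it accepts is filled with doctors it ranks higher. -/
theorem exists_individually_stable (M : Market D H) (P : Profile D H)
    (hd : ∀ d, StrictLinear (P.dpref d))
    (hh : ∀ h, StrictLinearOn {d | d ∈ P.acc h} (P.rank h)) :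
    ∃ μ : Matching M, (∀ d, weakPref (P.dpref d) (μ.assign d) none) ∧
      (∀ h, μ.assigned h ⊆ P.acc h) ∧
      ∀ d h, d ∈ P.acc h → P.dpref d (some h) (μ.assign d) →
        (μ.assigned h).card = M.κ h ∧ ∀ e ∈ μ.assigned h, P.rank h e d := by
  classical
  let avail (R : Finset (D × H)) (d : D) : Finset (Option H) :=
    univ.filter fun o => ∀ h, o = some h → (d, h) ∉ R
  have mem_avail R d o : o ∈ avail R d ↔ ∀ h, o = some h → (d, h) ∉ R := by simp [avail]
  have havail R d : (avail R d).Nonempty := ⟨none, by simp [avail]⟩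
  choose top top_mem top_best using
    fun (R : Finset (D × H)) d => (hd d).exists_top (avail R d) (havail R d)
  -- the rejection of a single application by its doctor's favourite leaves other applicants put
  have top_insert : ∀ R d h e k, top R e = some k → (e, k) ≠ (d, h) →
      top (insert (d, h) R) e = some k := by
    intro R d h e k hk hne
    have hsub : avail (insert (d, h) R) e ⊆ avail R e := by
      intro o ho
      rw [mem_avail] at ho ⊢
      intro j hj hR
      exact ho j hj (mem_insert_of_mem hR)
    have hmem : some k ∈ avail (insert (d, h) R) e := by
      rw [mem_avail]
      rintro j hj
      cases hj
      have := (mem_avail _ _ _).1 (top_mem R e) k hk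
      simp only [mem_insert, not_or]
      exact ⟨hne, this⟩
    have h1 := top_best _ _ _ hmem
    have h2 := top_best R e _ (hsub (top_mem (insert (d, h) R) e))
    rw [hk] at h2
    rcases h1 with h1 | h1
    · exact h1
    · rcases h2 with h2 | h2
      · exact h2.symm
      · exact absurd h1 ((hd e).2.2.2 _ trivial _ trivial h2)
  let better (R : Finset (D × H)) (d : D) (h : H) : Finset D :=
    univ.filter fun e => top R e = some h ∧ e ∈ P.acc h ∧ P.rank h e d
  let Inv (R : Finset (D × H)) : Prop :=
    ∀ d h, (d, h) ∈ R → d ∈ P.acc h → M.κ h ≤ (better R d h).card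
  obtain ⟨R, hR, hmax⟩ := Set.Finite.exists_maximal (s := {R | Inv R}) (Set.toFinite _)
    ⟨∅, fun d h hm => absurd hm (by simp)⟩
  have hR : Inv R := hR
  have top_notMem : ∀ d h, top R d = some h → (d, h) ∉ R :=
    fun d h hm => (mem_avail _ _ _).1 (top_mem R d) h hm
  have not_inv : ∀ d h, top R d = some h → ¬ Inv (insert (d, h) R) := fun d h hm hI =>
    top_notMem d h hm (hmax hI (subset_insert _ _) (mem_insert_self _ _))
  have hacc : ∀ d h, top R d = some h → d ∈ P.acc h := by
    intro d h hm
    by_contra hda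
    refine not_inv d h hm fun d' h' hmem ha' => ?_
    rcases mem_insert.1 hmem with heq | hmem
    · cases heq
      exact absurd ha' hda
    · refine (hR d' h' hmem ha').trans (card_le_card fun e he => ?_)
      simp only [better, mem_filter, mem_univ, true_and] at he ⊢
      refine ⟨top_insert _ _ _ _ _ he.1 ?_, he.2⟩
      rintro heq
      cases heq
      exact hda he.2.1
  have hquota : ∀ h, (univ.filter fun d => top R d = some h).card ≤ M.κ h := by
    intro h
    by_contra! hlt
    set A := univ.filter fun d => top R d = some h with hA
    have memA : ∀ e, e ∈ A ↔ top R e = some h := by simp [hA]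
    obtain ⟨d, hdA, hworst⟩ := (hh h).exists_bot A (card_pos.1 (by omega))
      fun a ha => hacc a h ((memA a).1 ha)
    have hdt := (memA d).1 hdA
    have herase : M.κ h ≤ (A.erase d).card := by rw [card_erase_of_mem hdA]; omega
    refine not_inv d h hdt fun d' h' hmem ha' => ?_
    have key : ∀ x, x ∈ P.acc h → (x = d ∨ P.rank h d x) →
        M.κ h ≤ (better (insert (d, h) R) x h).card := by
      intro x hx hdx
      refine herase.trans (card_le_card fun e he => ?_)
      obtain ⟨hne, heA⟩ := mem_erase.1 he
      have het := (memA e).1 heA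
      simp only [better, mem_filter, mem_univ, true_and]
      refine ⟨top_insert _ _ _ _ _ het (by simp [hne]), hacc e h het, ?_⟩
      rcases hdx with rfl | hdx
      · exact hworst e heA hne
      · exact (hh h).2.2.1 _ (hacc e h het) _ (hacc d h hdt) _ hx (hworst e heA hne) hdx
    rcases mem_insert.1 hmem with heq | hmem
    · cases heq
      exact key d ha' (Or.inl rfl)
    · by_cases hcase : h' = h ∧ P.rank h d d'
      · obtain ⟨rfl, hr⟩ := hcase
        exact key d' ha' (Or.inr hr)
      · refine (hR d' h' hmem ha').trans (card_le_card fun e he => ?_)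
        simp only [better, mem_filter, mem_univ, true_and] at he ⊢
        refine ⟨top_insert _ _ _ _ _ he.1 ?_, he.2⟩
        rintro heq
        cases heq
        exact hcase ⟨rfl, he.2.2⟩
  refine ⟨⟨top R, hquota⟩, fun d => top_best R d none (by simp [avail]), fun h e he => ?_, ?_⟩
  · exact hacc e h (by simpa [Matching.assigned] using he)
  · intro d h hda hpref
    have hrej : (d, h) ∈ R := by
      by_contra hn
      rcases top_best R d (some h) (by rw [mem_avail]; rintro j hj; cases hj; exact hn) with h1 | h1
      · exact (hd d).2.1 _ trivial (h1 ▸ hpref)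
      · exact (hd d).2.2.2 _ trivial _ trivial h1 hpref
    have hle := hR d h hrej hda
    have hsub : better R d h ⊆ univ.filter fun d => top R d = some h := fun e he => by
      simp only [better, mem_filter, mem_univ, true_and] at he ⊢
      exact he.1
    have heq := eq_of_subset_of_card_le hsub ((hquota h).trans hle)
    refine ⟨le_antisymm (hquota h) (hle.trans (card_le_card hsub)), fun e he => ?_⟩
    change e ∈ univ.filter fun d => top R d = some h at he
    rw [← heq] at he
    simp only [better, mem_filter, mem_univ, true_and] at he
    exact he.2.2

end Auxiliary

/-- **Theorem (part (i))**: if the profile `P₀` of responsive couple preferences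
satisfies extreme-altruism, then every responsive extension of `P₀` admits a
stable matching. -/
theorem extremeAltruism_implies_stable_exists
    {D H : Type} [Fintype D] [DecidableEq D] [Fintype H] [DecidableEq H]
    (M : Market D H)
    (hH : 2 ≤ Fintype.card H) (hD : 4 ≤ Fintype.card D)
    (hC : M.couples.Nonempty) (hκ : ∀ h : H, 2 ≤ M.κ h)
    (P₀ : Profile D H) (hP₀ : ∀ c ∈ M.couples, CoupleResponsive P₀ c)
    (hEA : ExtremeAltruism M P₀)
    (P : Profile D H) (hresp : Responsive M P) (hext : CoupleExtension M P₀ P) :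
    ∃ μ : Matching M, Stable M P μ := by
  have hd : ∀ d, StrictLinear (P.dpref d) := by
    intro d
    by_cases hs : M.Single d
    · exact hresp.2.2 d hs
    · simp only [Market.Single, not_forall] at hs
      obtain ⟨c, hc, hdc⟩ := hs
      obtain ⟨-, h1, h2, -⟩ := hresp.2.1 c hc
      by_cases h : d = c.1
      · exact h ▸ h1
      · have : d = c.2 := by_contra fun h' => hdc ⟨h, h'⟩
        exact this ▸ h2
  have hEA' : ExtremeAltruism M P := by
    intro c hc
    obtain ⟨h1, h2, h3⟩ := hext c hc
    rw [h1, h2, h3]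
    exact hEA c hc
  obtain ⟨μ, hir, hacc, hst⟩ := exists_individually_stable M P hd fun h => (hresp.1 h).1
  exact ⟨μ, hEA'.stable hresp hd hir hacc hst⟩

end CouplesMarket
end

section
/- Let P⁰_C be a profile of responsive couple preferences satisfying extreme-altruism. Then for every couple c = {f,m} and all hospitals h₁, h₂ ∈ H such that h P⁰_f λ and h P⁰_m λ for both h ∈ {h₁,h₂}, one has h₁ P⁰_f h₂ if and only if h₁ P⁰_m h₂. -/
namespace CouplesMarket

/-- Under extreme-altruism, the members of a couple cannot rank two hospitals oppositely when the
hospital preferred by either member is acceptable to the other. -/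
theorem ExtremeAltruism.not_opposite_ranking {D H : Type} [Fintype D]
    {M : Market D H} {P : Profile D H} (hEA : ExtremeAltruism M P)
    (hκ : ∀ h : H, M.κ h ≤ Fintype.card D - 2) {c : D × D} (hc : c ∈ M.couples)
    (hresp : CoupleResponsive P c) {a b : H}
    (ha : P.dpref c.2 (some a) none) (hb : P.dpref c.1 (some b) none)
    (hab : P.dpref c.1 (some a) (some b)) (hba : P.dpref c.2 (some b) (some a)) : False :=
  hresp.1.2.2.2 _ trivial _ trivial
    ((hEA c hc b (hκ b) (some a) (some a)).1 ⟨hab, Or.inl rfl, Or.inr ha⟩)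
    ((hEA c hc a (hκ a) (some b) (some b)).2 ⟨hba, Or.inl rfl, Or.inr hb⟩)

/-- **Lemma**: under extreme-altruism, if two hospitals are both acceptable to
both members of a couple, then the two members rank them the same way. -/
theorem extremeAltruism_same_ranking
    {D H : Type} [Fintype D] [DecidableEq D] [Fintype H] [DecidableEq H]
    (M : Market D H)
    (hH : 2 ≤ Fintype.card H) (hD : 4 ≤ Fintype.card D)
    (hC : M.couples.Nonempty) (hκ : ∀ h : H, 2 ≤ M.κ h)
    (hκ' : ∀ h : H, M.κ h ≤ Fintype.card D - 2)
    (P₀ : Profile D H) (hP₀ : ∀ c ∈ M.couples, CoupleResponsive P₀ c)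
    (hEA : ExtremeAltruism M P₀) :
    ∀ c ∈ M.couples, ∀ h₁ h₂ : H,
      P₀.dpref c.1 (some h₁) none → P₀.dpref c.2 (some h₁) none →
      P₀.dpref c.1 (some h₂) none → P₀.dpref c.2 (some h₂) none →
      (P₀.dpref c.1 (some h₁) (some h₂) ↔ P₀.dpref c.2 (some h₁) (some h₂)) := by
  intro c hc h₁ h₂ hf₁ hm₁ hf₂ hm₂
  have hresp := hP₀ c hc
  obtain ⟨-, hf, hm, -⟩ := id hresp
  constructor
  · intro h
    rcases hm.1 (some h₁) trivial (some h₂) trivial with heq | hlt | hgt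
    · exact (hf.2.1 _ trivial (heq ▸ h)).elim
    · exact hlt
    · exact (hEA.not_opposite_ranking hκ' hc hresp hm₁ hf₂ h hgt).elim
  · intro h
    rcases hf.1 (some h₁) trivial (some h₂) trivial with heq | hlt | hgt
    · exact (hm.2.1 _ trivial (heq ▸ h)).elim
    · exact hlt
    · exact (hEA.not_opposite_ranking hκ' hc hresp hm₂ hf₁ hgt h).elim

end CouplesMarket
end

section
/- Consider the market with a single hospital H = {h₁} of capacity κ_{h₁} = 2 and doctors D = {d₁,d₂,f,m}, where c = {f,m} is the unique couple and d₁,d₂ are single. The hospital finds all four doctors acceptable with individual ranking P̄_{h₁}: f, d₁, d₂, m, and its responsive preference over two-element sets is {f,d₁} P_{h₁} {f,d₂} P_{h₁} {f,m} P_{h₁} {d₁,d₂} P_{h₁} {d₁,m} P_{h₁} {d₂,m}, with every two-element set preferred to every smaller feasible set. The single doctors rank h₁ above λ; the couple's marginals are P_f: λ above h₁ and P_m: h₁ above λ; and the couple's responsive preference is (λ,h₁) P_c (h₁,h₁) P_c (λ,λ) P_c (h₁,λ). Then no stable matching exists for this profile. -/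
namespace CouplesMarket

/- Example 2 of the paper: a single hospital `h₁ = 0 : Fin 1` of capacity 2;
doctors `d₁ = 0, d₂ = 1, f = 2, m = 3 : Fin 4` with the unique couple
`c = (f, m) = (2, 3)`. -/
def exampleMarket2 : Market (Fin 4) (Fin 1) where
  κ := fun _ => 2
  couples := {((2 : Fin 4), (3 : Fin 4))}
  couples_ne := by decide
  couples_disjoint := by decide

/-- A hospital whose assignment is `S` prefers `A` to it as soon as the feasible set
`(S \ B) ∪ A` is preferred to `S` for some `B ⊆ S` disjoint from `A`. -/
theorem hosPrefers_of_assigned_eq {D H : Type} [Fintype D] [DecidableEq D] [DecidableEq H]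
    {M : Market D H} {P : Profile D H} {μ : Matching M} {h : H}
    {S A T : Finset D} (B : Finset D) (hS : μ.assigned h = S) (hB : B ⊆ S) (hAB : Disjoint A B)
    (hT : (S \ B) ∪ A = T) (hcard : T.card ≤ M.κ h) (hpref : P.hpref h T S) :
    HosPrefers M P μ (some h) A := by
  subst hS hT
  exact ⟨B, hB, hAB, hcard, hpref⟩

/-- **Example 2**: no stable matching exists for the profile of Table 2. -/
theorem example2_no_stable_matching
    (P : Profile (Fin 4) (Fin 1))
    (hresp : Responsive exampleMarket2 P)
    (hacc : P.acc 0 = Finset.univ)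
    -- `P̄_{h₁} : f, d₁, d₂, m`
    (hr : P.rank 0 2 0 ∧ P.rank 0 0 1 ∧ P.rank 0 1 3)
    -- `{f,d₁} P {f,d₂} P {f,m} P {d₁,d₂} P {d₁,m} P {d₂,m}`
    (hsets : P.hpref 0 {2, 0} {2, 1} ∧ P.hpref 0 {2, 1} {2, 3} ∧
      P.hpref 0 {2, 3} {0, 1} ∧ P.hpref 0 {0, 1} {0, 3} ∧ P.hpref 0 {0, 3} {1, 3})
    -- every two-element set preferred to every smaller feasible set
    (hsmall : ∀ A B : Finset (Fin 4), A.card = 2 → B.card ≤ 1 → P.hpref 0 A B)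
    -- single doctors rank `h₁` above `λ`
    (hd1 : P.dpref 0 (some 0) none) (hd2 : P.dpref 1 (some 0) none)
    -- couple marginals: `λ P_f h₁` and `h₁ P_m λ`
    (hf : P.dpref 2 none (some 0)) (hm : P.dpref 3 (some 0) none)
    -- `(λ,h₁) P_c (h₁,h₁) P_c (λ,λ) P_c (h₁,λ)`
    (hc : P.cpref (2, 3) (none, some 0) (some 0, some 0) ∧
          P.cpref (2, 3) (some 0, some 0) (none, none) ∧
          P.cpref (2, 3) (none, none) (some 0, none)) :
    ¬ ∃ μ : Matching exampleMarket2, Stable exampleMarket2 P μ := by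
  rintro ⟨μ, hsingle, hcouple, -⟩
  obtain ⟨-, -, h2301, h0103, h0313⟩ := hsets
  obtain ⟨hc₁, hc₂, hc₃⟩ := hc
  have cases_assign : ∀ d, μ.assign d = none ∨ μ.assign d = some 0 := fun d => by
    cases h : μ.assign d with
    | none => exact .inl rfl
    | some x => exact .inr (congrArg some (Subsingleton.elim x 0))
  have hmem : ((2, 3) : Fin 4 × Fin 4) ∈ exampleMarket2.couples := by decide
  have single0 : exampleMarket2.Single 0 := by unfold Market.Single; decide
  have single1 : exampleMarket2.Single 1 := by unfold Market.Single; decide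
  have assigned_eq : ∀ S : Finset (Fin 4), (∀ d, μ.assign d = some 0 ↔ d ∈ S) →
      μ.assigned 0 = S := fun S h => by
    ext d
    simp [Matching.assigned, h]
  have block0 : μ.assign 0 = none → ¬ HosPrefers exampleMarket2 P μ (some 0) {0} :=
    fun h hp => hsingle (some 0) 0 single0 ⟨by rwa [h], hp⟩
  have block1 : μ.assign 1 = none → ¬ HosPrefers exampleMarket2 P μ (some 0) {1} :=
    fun h hp => hsingle (some 0) 1 single1 ⟨by rwa [h], hp⟩
  have blockc : μ.assign 2 = none → μ.assign 3 = none →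
      ¬ HosPrefers exampleMarket2 P μ (some 0) {2, 3} := fun h2 h3 hp =>
    hcouple (some 0) (some 0) (2, 3) hmem
      ⟨by simpa only [h2, h3] using hc₂, fun h => absurd rfl h, fun h => absurd rfl h, fun _ => hp⟩
  have h2 : μ.assign 2 = none := by
    refine (cases_assign 2).resolve_right fun h2 => ?_
    rcases cases_assign 3 with h3 | h3
    · exact hcouple none none (2, 3) hmem
        ⟨by simpa only [h2, h3] using hc₃, fun h => absurd rfl h, fun h => absurd rfl h,
          fun _ => trivial⟩
    · exact hcouple none (some 0) (2, 3) hmem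
        ⟨by simpa only [h2, h3] using hc₁, fun _ _ => trivial, fun _ h => absurd h3 h, nofun⟩
  rcases cases_assign 0 with h0 | h0 <;> rcases cases_assign 1 with h1 | h1 <;>
    rcases cases_assign 3 with h3 | h3
  · have hS := assigned_eq ∅ (by simp [Fin.forall_fin_succ, h0, h1, h2, h3])
    exact blockc h2 h3 (hosPrefers_of_assigned_eq (T := {2, 3}) ∅ hS (by decide) (by decide)
      (by decide) (by decide) (hsmall _ _ (by decide) (by decide)))
  · have hS := assigned_eq {3} (by simp [Fin.forall_fin_succ, h0, h1, h2, h3])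
    exact block0 h0 (hosPrefers_of_assigned_eq (T := {0, 3}) ∅ hS (by decide) (by decide)
      (by decide) (by decide) (hsmall _ _ (by decide) (by decide)))
  · have hS := assigned_eq {1} (by simp [Fin.forall_fin_succ, h0, h1, h2, h3])
    exact block0 h0 (hosPrefers_of_assigned_eq (T := {0, 1}) ∅ hS (by decide) (by decide)
      (by decide) (by decide) (hsmall _ _ (by decide) (by decide)))
  · have hS := assigned_eq {1, 3} (by simp [Fin.forall_fin_succ, h0, h1, h2, h3])
    exact block0 h0 (hosPrefers_of_assigned_eq (T := {0, 3}) {1} hS (by decide) (by decide)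
      (by decide) (by decide) h0313)
  · have hS := assigned_eq {0} (by simp [Fin.forall_fin_succ, h0, h1, h2, h3])
    exact block1 h1 (hosPrefers_of_assigned_eq (T := {0, 1}) ∅ hS (by decide) (by decide)
      (by decide) (by decide) (hsmall _ _ (by decide) (by decide)))
  · have hS := assigned_eq {0, 3} (by simp [Fin.forall_fin_succ, h0, h1, h2, h3])
    exact block1 h1 (hosPrefers_of_assigned_eq (T := {0, 1}) {3} hS (by decide) (by decide)
      (by decide) (by decide) h0103)
  · have hS := assigned_eq {0, 1} (by simp [Fin.forall_fin_succ, h0, h1, h2, h3])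
    exact blockc h2 h3 (hosPrefers_of_assigned_eq (T := {2, 3}) {0, 1} hS (by decide) (by decide)
      (by decide) (by decide) h2301)
  · have hq := μ.quota 0
    have hS := assigned_eq {0, 1, 3} (by simp [Fin.forall_fin_succ, h0, h1, h2, h3])
    rw [Matching.assigned] at hS
    rw [hS] at hq
    exact absurd hq (by decide)

end CouplesMarket
end

section
/- For every preference profile P with responsive hospital and couple preferences, there exists an individually rational matching μ such that for every doctor d ∈ D and hospital h ∈ H with d ∉ μ(h) and h P_d μ(d) (where P_d is d's individual preference if d is single and d's marginal preference if d belongs to a couple), either d ∉ D_h, or |μ(h)| = κ_h and d′ P̄_h d for every d′ ∈ μ(h). -/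
namespace CouplesMarket

theorem StrictLinearOn.swap {α : Type} {s : Set α} {r : α → α → Prop}
    (hr : StrictLinearOn s r) : StrictLinearOn s (fun a b => r b a) := by
  obtain ⟨tri, irr, tr, asy⟩ := hr
  refine ⟨fun a ha b hb => ?_, irr, fun a ha b hb c hc hab hbc => tr c hc b hb a ha hbc hab,
    fun a ha b hb => asy b hb a ha⟩
  rcases tri a ha b hb with h | h | h
  exacts [Or.inl h, Or.inr (Or.inr h), Or.inr (Or.inl h)]

/-- A nonempty finite subset of the domain of a strict linear order has a best element. -/
theorem StrictLinearOn.exists_best {α : Type} {s : Set α} {r : α → α → Prop}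
    (hr : StrictLinearOn s r) {T : Finset α} (hT : T.Nonempty) (hTs : ∀ a ∈ T, a ∈ s) :
    ∃ a ∈ T, ∀ b ∈ T, weakPref r a b := by
  classical
  induction hT using Finset.Nonempty.cons_induction with
  | singleton a => exact ⟨a, by simp, fun b hb => Or.inl (Finset.mem_singleton.mp hb).symm⟩
  | cons x T hx hT ih =>
    obtain ⟨a, haT, ha⟩ := ih fun b hb => hTs b (Finset.mem_cons_of_mem hb)
    have hxs := hTs x (Finset.mem_cons_self x T)
    have has := hTs a (Finset.mem_cons_of_mem haT)
    by_cases hxa : r x a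
    · refine ⟨x, Finset.mem_cons_self x T, fun b hb => ?_⟩
      rcases Finset.mem_cons.mp hb with rfl | hbT
      · exact Or.inl rfl
      · rcases ha b hbT with rfl | hab
        · exact Or.inr hxa
        · exact Or.inr (hr.2.2.1 x hxs a has b (hTs b hb) hxa hab)
    · refine ⟨a, Finset.mem_cons_of_mem haT, fun b hb => ?_⟩
      rcases Finset.mem_cons.mp hb with rfl | hbT
      · rcases hr.1 a has b hxs with h | h | h
        exacts [Or.inl h, Or.inr h, absurd h hxa]
      · exact ha b hbT

theorem StrictLinear.weakPref_antisymm {α : Type} {r : α → α → Prop} (hr : StrictLinear r)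
    {a b : α} (hab : weakPref r a b) (hba : weakPref r b a) : a = b := by
  rcases hab with h | h
  · exact h
  · rcases hba with h' | h'
    · exact h'.symm
    · exact absurd h' (hr.2.2.2 a trivial b trivial h)

/-- `a` is the best option for doctor `d` after the rejections recorded in `R`. -/
def IsBestOption {D H : Type} (pref : D → Option H → Option H → Prop) (R : Finset (D × H))
    (d : D) (a : Option H) : Prop :=
  (∀ h, a = some h → (d, h) ∉ R) ∧ weakPref (pref d) a none ∧
    ∀ h, (d, h) ∉ R → weakPref (pref d) a (some h)

theorem exists_isBestOption {D H : Type} [Fintype H] {pref : D → Option H → Option H → Prop}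
    (hpref : ∀ d, StrictLinear (pref d)) (R : Finset (D × H)) (d : D) :
    ∃ a, IsBestOption pref R d a := by
  classical
  obtain ⟨a, ha, hbest⟩ := (hpref d).exists_best
    (T := Finset.univ.filter fun a : Option H => ∀ h, a = some h → (d, h) ∉ R)
    ⟨none, by simp⟩ (fun _ _ => trivial)
  refine ⟨a, (Finset.mem_filter.mp ha).2, hbest none (by simp), fun h hh => hbest _ ?_⟩
  simp only [Finset.mem_filter, Finset.mem_univ, true_and]
  rintro h' h_eq
  cases h_eq
  exact hh

/-- A best option that is not itself rejected stays best after a further rejection. -/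
theorem IsBestOption.eq_of_insert {D H : Type} [DecidableEq D] [DecidableEq H]
    {pref : D → Option H → Option H → Prop} (hpref : ∀ d, StrictLinear (pref d))
    {R : Finset (D × H)} {p : D × H} {d : D} {h : H} {b : Option H}
    (ha : IsBestOption pref R d (some h)) (hb : IsBestOption pref (insert p R) d b)
    (hp : (d, h) ≠ p) : b = some h := by
  refine (hpref d).weakPref_antisymm (hb.2.2 h ?_) ?_
  · rw [Finset.mem_insert, not_or]
    exact ⟨hp, ha.1 h rfl⟩
  · cases b with
    | none => exact ha.2.1
    | some h' => exact ha.2.2 h' fun hR => hb.1 h' rfl (Finset.mem_insert_of_mem hR)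

/-- Existence of stable assignments of doctors to hospitals, by deferred acceptance: a maximal
set of justified rejections leaves every doctor with a best option that is available. -/
theorem exists_stable_assign {D H : Type} [Fintype D] [DecidableEq D] [Fintype H] [DecidableEq H]
    (κ : H → ℕ) (acc : H → Finset D) (rank : H → D → D → Prop)
    (pref : D → Option H → Option H → Prop) (hpref : ∀ d, StrictLinear (pref d))
    (hrank : ∀ h, StrictLinearOn {d | d ∈ acc h} (rank h)) :
    ∃ f : D → Option H,
      (∀ h, (Finset.univ.filter fun d => f d = some h).card ≤ κ h) ∧
      (∀ d, weakPref (pref d) (f d) none) ∧ (∀ d h, f d = some h → d ∈ acc h) ∧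
      ∀ d h, pref d (some h) (f d) → d ∉ acc h ∨
        ((Finset.univ.filter fun d => f d = some h).card = κ h ∧
          ∀ d', f d' = some h → rank h d' d) := by
  classical
  choose f hf using exists_isBestOption hpref
  let better (R : Finset (D × H)) (d : D) (h : H) : Finset D :=
    Finset.univ.filter fun d' => f R d' = some h ∧ d' ∈ acc h ∧ rank h d' d
  let Justified (R : Finset (D × H)) : Prop :=
    ∀ d h, (d, h) ∈ R → d ∈ acc h → κ h ≤ (better R d h).card
  obtain ⟨R, hR, hmax⟩ := (Finset.univ.filter Justified).exists_max_image Finset.card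
    ⟨∅, by simp [Justified]⟩
  replace hR : Justified R := (Finset.mem_filter.mp hR).2
  have hstep : ∀ p ∉ R, ¬ Justified (insert p R) := by
    intro p hp hJ
    have := hmax (insert p R) (by simpa using hJ)
    rw [Finset.card_insert_of_notMem hp] at this
    omega
  have hacc : ∀ d h, f R d = some h → d ∈ acc h := by
    intro d h hd
    by_contra hda
    refine hstep (d, h) ((hf R d).1 h hd) fun x k hx hxa => ?_
    have hxR : (x, k) ∈ R := by
      rcases Finset.mem_insert.mp hx with h_eq | h'
      · cases h_eq
        exact absurd hxa hda
      · exact h'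
    refine (hR x k hxR hxa).trans (Finset.card_le_card fun y hy => ?_)
    simp only [better, Finset.mem_filter, Finset.mem_univ, true_and] at hy ⊢
    refine ⟨(hy.1 ▸ hf R y).eq_of_insert hpref (hf _ y) ?_, hy.2⟩
    rintro h_eq
    cases h_eq
    exact hda hy.2.1
  have hcap : ∀ h, (Finset.univ.filter fun d => f R d = some h).card ≤ κ h := by
    intro h
    by_contra! hlt
    obtain ⟨d, hd, hworst⟩ := (hrank h).swap.exists_best
      (T := Finset.univ.filter fun d => f R d = some h) (Finset.card_pos.mp (by omega))
      (fun a ha => hacc a h (Finset.mem_filter.mp ha).2)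
    have hdh : f R d = some h := (Finset.mem_filter.mp hd).2
    have hstay : ∀ y k, f R y = some k → (y, k) ≠ (d, h) →
        f (insert (d, h) R) y = some k := fun y k hy hne =>
      (hy ▸ hf R y).eq_of_insert hpref (hf _ y) hne
    have hothers : κ h ≤ ((Finset.univ.filter fun d => f R d = some h).erase d).card := by
      rw [Finset.card_erase_of_mem hd]
      omega
    have hbelow : ∀ y ∈ (Finset.univ.filter fun d => f R d = some h).erase d,
        f (insert (d, h) R) y = some h ∧ y ∈ acc h ∧ rank h y d := by
      intro y hy
      obtain ⟨hne, hy⟩ := Finset.mem_erase.mp hy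
      have hyh : f R y = some h := (Finset.mem_filter.mp hy).2
      refine ⟨hstay y h hyh (by simpa using hne), hacc y h hyh, ?_⟩
      exact (hworst y hy).resolve_left (Ne.symm hne)
    refine hstep (d, h) ((hf R d).1 h hdh) fun x k hx hxa => ?_
    rcases Finset.mem_insert.mp hx with h_eq | hxR
    · cases h_eq
      refine hothers.trans (Finset.card_le_card fun y hy => ?_)
      simpa [better] using hbelow y hy
    · by_cases hdx : k = h ∧ rank h d x
      · obtain ⟨rfl, hdx⟩ := hdx
        refine hothers.trans (Finset.card_le_card fun y hy => ?_)
        obtain ⟨hy1, hy2, hy3⟩ := hbelow y hy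
        simp only [better, Finset.mem_filter, Finset.mem_univ, true_and]
        exact ⟨hy1, hy2, (hrank k).2.2.1 y hy2 d (hacc d k hdh) x hxa hy3 hdx⟩
      · refine (hR x k hxR hxa).trans (Finset.card_le_card fun y hy => ?_)
        simp only [better, Finset.mem_filter, Finset.mem_univ, true_and] at hy ⊢
        refine ⟨hstay y k hy.1 ?_, hy.2⟩
        rintro h_eq
        cases h_eq
        exact hdx ⟨rfl, hy.2.2⟩
  refine ⟨f R, hcap, fun d => (hf R d).2.1, hacc, fun d h hdh => ?_⟩
  refine or_iff_not_imp_left.mpr fun hda => ?_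
  have hdR : (d, h) ∈ R := by
    by_contra hn
    rcases (hf R d).2.2 h hn with h_eq | h'
    · rw [h_eq] at hdh
      exact (hpref d).2.1 _ trivial hdh
    · exact (hpref d).2.2.2 _ trivial _ trivial hdh h'
  have hsub : better R d h ⊆ Finset.univ.filter fun d => f R d = some h :=
    fun y hy => by
      simp only [better, Finset.mem_filter, Finset.mem_univ, true_and] at hy ⊢
      exact hy.1
  have hle := hR d h hdR (not_not.mp hda)
  have heq := Finset.eq_of_subset_of_card_le hsub ((hcap h).trans hle)
  refine ⟨le_antisymm (hcap h) (heq ▸ hle), fun y hy => ?_⟩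
  have hy' : y ∈ better R d h := by
    rw [heq]
    simpa using hy
  simp only [better, Finset.mem_filter] at hy'
  exact hy'.2.2.2

theorem Responsive.strictLinear_dpref {D H : Type} {M : Market D H} {P : Profile D H}
    [Fintype D] [DecidableEq D] [Fintype H] [DecidableEq H]
    (hresp : Responsive M P) (d : D) : StrictLinear (P.dpref d) := by
  by_cases hd : M.Single d
  · exact hresp.2.2 d hd
  · simp only [Market.Single, not_forall] at hd
    obtain ⟨c, hc, hd⟩ := hd
    rw [← not_or, not_not] at hd
    obtain ⟨-, h₁, h₂, -⟩ := hresp.2.1 c hc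
    rcases hd with rfl | rfl
    exacts [h₁, h₂]

theorem CoupleResponsive.weakPref_none {D H : Type} [Fintype D] [DecidableEq D] [Fintype H]
    [DecidableEq H] {P : Profile D H} {c : D × D} (hc : CoupleResponsive P c) {a b : Option H}
    (ha : weakPref (P.dpref c.1) a none) (hb : weakPref (P.dpref c.2) b none) :
    weakPref (P.cpref c) (a, b) (none, none) := by
  obtain ⟨hlin, -, -, hr⟩ := hc
  rcases ha with rfl | ha
  · rcases hb with rfl | hb
    · exact Or.inl rfl
    · exact Or.inr ((hr none b none).2.mpr hb)
  · have hab := (hr b a none).1.mpr ha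
    rcases hb with rfl | hb
    · exact Or.inr hab
    · exact Or.inr (hlin.2.2.1 _ trivial _ trivial _ trivial hab ((hr none b none).2.mpr hb))

/-- **DPDA outcome**: for every responsive profile there is an individually
rational matching `μ` such that whenever a doctor `d` prefers a hospital `h`
to his/her assignment, either `d` is unacceptable to `h`, or `h` is full and
every doctor in `μ(h)` is ranked above `d` by `h`. -/
theorem exists_indivRational_no_justified_envy
    {D H : Type} [Fintype D] [DecidableEq D] [Fintype H] [DecidableEq H]
    (M : Market D H) (hκ : ∀ h : H, 2 ≤ M.κ h)
    (P : Profile D H) (hresp : Responsive M P) :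
    ∃ μ : Matching M, IndivRational M P μ ∧
      ∀ (d : D) (h : H), d ∉ μ.assigned h → P.dpref d (some h) (μ.assign d) →
        (d ∉ P.acc h ∨
          ((μ.assigned h).card = M.κ h ∧ ∀ d' ∈ μ.assigned h, P.rank h d' d)) := by
  obtain ⟨f, hcap, hir, hacc, hst⟩ := exists_stable_assign M.κ P.acc P.rank P.dpref
    hresp.strictLinear_dpref fun h => (hresp.1 h).1
  refine ⟨⟨f, hcap⟩, ⟨fun s _ => hir s,
    fun c hc => (hresp.2.1 c hc).weakPref_none (hir c.1) (hir c.2),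
    fun h d hd => hacc d h (Finset.mem_filter.mp hd).2⟩, fun d h _ hd => ?_⟩
  exact (hst d h hd).imp_right fun hfull =>
    ⟨hfull.1, fun d' hd' => hfull.2 d' (Finset.mem_filter.mp hd').2⟩

end CouplesMarket
end
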